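/- (Capacity growth-saturation across scales.) Let d ≥ 3, let M > 4 be an integer with M^2 > 3^d + 1, and let c_* = sup{ g(x,y)|y-x|^{d-2} : x,y ∈ Z^d }. Set η_0 = (c_* M^d)^{-1} and η̃_0 = η_0/2. Let L_1 ≥ 1 satisfy L_1^{d-2} g(0,0) > 2 c_* M^d. Let F ⊆ Z^d and let B̄ ⊆ Z^d be a box of side length M·L, partitioned into M^d subboxes B̂ of side length L ≥ L_1. Then cap(B̄ ∩ F)/|B̄|^{(d-2)/d} ≥ (M^2/(3^d+1)) · M^{-d} · Σ_{B̂ ⊆ B̄} min( cap(B̂ ∩ F)/|B̂|^{(d-2)/d}, η̃_0 ). -/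

import Mathlib

open scoped Classical
open Filter

noncomputable section

abbrev V (d : ℕ) := Fin d → ℤ

variable {d : ℕ}

/-- sup-norm of a lattice point. -/
def supNorm (x : V d) : ℕ := Finset.univ.sup fun i => (x i).natAbs

/-- ℓ¹-norm of a lattice point. -/
def l1Norm (x : V d) : ℕ := ∑ i, (x i).natAbs

/-- Euclidean norm of a lattice point. -/
def eNorm (x : V d) : ℝ := Real.sqrt (∑ i, ((x i : ℝ)) ^ 2)

/-- closed sup-norm ball `B(x,r)` as a `Finset`. -/
def ball (x : V d) (r : ℤ) : Finset (V d) := Fintype.piFinset fun i => Finset.Icc (x i - r) (x i + r)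

/-- box of side `L` with base point `x`. -/
def box (x : V d) (L : ℤ) : Finset (V d) := Fintype.piFinset fun i => Finset.Ico (x i) (x i + L)

/-- nearest neighbours of `x` in `ℤ^d`. -/
def nbrs (x : V d) : Finset (V d) :=
  (Finset.univ : Finset (Fin d × Bool)).image
    fun p => Function.update x p.1 (x p.1 + if p.2 then 1 else -1)

/-- `n`-step transition probability of the simple random walk on `ℤ^d`. -/
def step (d : ℕ) : ℕ → V d → V d → ℝ
  | 0, x, y => if x = y then 1 else 0
  | n+1, x, y => ∑ z ∈ nbrs x, (1 / (2 * (d : ℝ))) * step d n z y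

/-- Green function of the simple random walk on `ℤ^d` (`d ≥ 3`); for the
continuous-time walk with unit jump rate it coincides with the expected number of
visits of the discrete-time walk. -/
def green (x y : V d) : ℝ := ∑' n, step d n x y

/-- `n`-step transition probability of the walk killed outside `U`. -/
def stepK (d : ℕ) (U : Set (V d)) : ℕ → V d → V d → ℝ
  | 0, x, y => if x = y ∧ x ∈ U then 1 else 0
  | n+1, x, y => if x ∈ U then ∑ z ∈ nbrs x, (1 / (2 * (d : ℝ))) * stepK d U n z y else 0

/-- Green function of the walk killed outside `U`. -/
def greenK (U : Set (V d)) (x y : V d) : ℝ := ∑' n, stepK d U n x y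

/-- probability of entering `F` within `n` steps and before exiting `U`. -/
def hitBE (F : Finset (V d)) (U : Set (V d)) : ℕ → V d → ℝ
  | 0, x => if x ∈ F then 1 else 0
  | n+1, x => if x ∈ F then 1 else
      if x ∈ U then ∑ z ∈ nbrs x, (1 / (2 * (d : ℝ))) * hitBE F U n z else 0

/-- `P_x[H_F < T_U]`. -/
def hitBeforeExit (F : Finset (V d)) (U : Set (V d)) (x : V d) : ℝ := ⨆ n, hitBE F U n x

/-- `P_x[H_F < ∞]`. -/
def hitProb (F : Finset (V d)) (x : V d) : ℝ := hitBeforeExit F Set.univ x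

/-- equilibrium measure `e_A(x) = P_x[H̃_A = ∞] 1_A(x)`. -/
def eqm (A : Finset (V d)) (x : V d) : ℝ :=
  if x ∈ A then ∑ z ∈ nbrs x, (1 / (2 * (d : ℝ))) * (1 - hitProb A z) else 0

/-- capacity of a finite set. -/
def capa (A : Finset (V d)) : ℝ := ∑ x ∈ A, eqm A x

/-- local density `σ_m(x)` of `U₁` in `B(x, 2^m L₁)`. -/
def dens (U₁ : Set (V d)) (L₁ : ℤ) (m : ℕ) (x : V d) : ℝ :=
  (((ball x (2 ^ m * L₁)).filter (· ∈ U₁)).card : ℝ) / ((ball x (2 ^ m * L₁)).card : ℝ)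

/-- average of `f` over `B(x,r)` w.r.t. the normalized counting measure. -/
def ballAvg (x : V d) (r : ℤ) (f : V d → ℝ) : ℝ :=
  (∑ y ∈ ball x r, f y) / ((ball x r).card : ℝ)

/-- `m_{x,r}`-measure of `{y : P y}`. -/
def frac (x : V d) (r : ℤ) (P : V d → Prop) : ℝ :=
  (((ball x r).filter P).card : ℝ) / ((ball x r).card : ℝ)
/-- the transition operator of the simple random walk. -/
def avg (d : ℕ) : (V d → ℝ) →ₗ[ℝ] (V d → ℝ) where
  toFun f x := ∑ z ∈ nbrs x, (1 / (2 * (d : ℝ))) * f z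
  map_add' f g := by
    ext x
    simp [mul_add, Finset.sum_add_distrib]
  map_smul' c f := by
    ext x
    simp only [Pi.smul_apply, smul_eq_mul, RingHom.id_apply, Finset.mul_sum]
    exact Finset.sum_congr rfl fun z _ => by ring

lemma avg_apply (f : V d → ℝ) (x : V d) :
    avg d f x = ∑ z ∈ nbrs x, (1 / (2 * (d : ℝ))) * f z := rfl

lemma avg_mono : Monotone (avg d) := fun f g h x => by
  simp only [avg_apply]
  exact Finset.sum_le_sum fun z _ => mul_le_mul_of_nonneg_left (h z) (by positivity)

lemma avg_pow_mono (n : ℕ) : Monotone ⇑(avg d ^ n) := by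
  rw [Module.End.coe_pow]
  exact avg_mono.iterate n

lemma avg_pow_succ (n : ℕ) (f : V d → ℝ) : (avg d ^ (n + 1)) f = avg d ((avg d ^ n) f) := by
  rw [pow_succ', Module.End.mul_apply]

lemma card_nbrs (x : V d) : (nbrs x).card = 2 * d := by
  unfold nbrs
  rw [Finset.card_image_of_injective]
  · simp [mul_comm]
  · rintro ⟨i, a⟩ ⟨j, b⟩ h
    have h1 := congrFun h i
    by_cases hij : i = j
    · subst hij
      cases a <;> cases b <;> simp at h1 ⊢
    · simp only [Function.update_self, Function.update_of_ne hij] at h1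
      cases a <;> simp at h1

lemma avg_one (hd : 0 < d) (x : V d) : avg d 1 x = 1 := by
  have : (d : ℝ) ≠ 0 := by positivity
  simp only [avg_apply, Pi.one_apply, mul_one, Finset.sum_const, card_nbrs, nsmul_eq_mul]
  push_cast
  field_simp

lemma mem_nbrs {x z : V d} :
    z ∈ nbrs x ↔ ∃ i, z = Function.update x i (x i + 1) ∨ z = Function.update x i (x i - 1) := by
  simp only [nbrs, Finset.mem_image, Finset.mem_univ, true_and, Prod.exists, Bool.exists_bool]
  refine exists_congr fun i => ?_
  simp only [if_true, Bool.false_eq_true, if_false, ← sub_eq_add_neg]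
  rw [or_comm, eq_comm, eq_comm (a := z) (b := Function.update x i (x i - 1))]

lemma mem_nbrs_symm {x z : V d} (h : z ∈ nbrs x) : x ∈ nbrs z := by
  rw [mem_nbrs] at h ⊢
  obtain ⟨i, rfl | rfl⟩ := h
  · exact ⟨i, Or.inr (by simp)⟩
  · exact ⟨i, Or.inl (by simp)⟩

/-- `ℤ^d` is connected. -/
lemma forall_of_nbrs {Q : V d → Prop} (x : V d) (hx : Q x)
    (hQ : ∀ x, Q x → ∀ z ∈ nbrs x, Q z) (y : V d) : Q y := by
  have upd : ∀ (u : V d) (i : Fin d) (k : ℤ), Q u → Q (Function.update u i k) := by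
    intro u i k hu
    induction k using Int.inductionOn' (b := u i) with
    | zero => simpa using hu
    | succ k _ ih => exact hQ _ ih _ (mem_nbrs.2 ⟨i, Or.inl (by simp)⟩)
    | pred k _ ih => exact hQ _ ih _ (mem_nbrs.2 ⟨i, Or.inr (by simp)⟩)
  have key : ∀ s : Finset (Fin d), Q (fun i => if i ∈ s then y i else x i) := by
    intro s
    induction s using Finset.induction_on with
    | empty => simpa using hx
    | insert a s _ ih =>
      convert upd _ a (y a) ih using 1
      ext i
      by_cases h : i = a
      · subst h; simp
      · simp [h]
  simpa using key Finset.univ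

lemma step_nonneg (n : ℕ) (x y : V d) : 0 ≤ step d n x y := by
  induction n generalizing x with
  | zero => simp only [step]; split_ifs <;> norm_num
  | succ n ih => exact Finset.sum_nonneg fun z _ => mul_nonneg (by positivity) (ih z)

lemma step_succ_right (n : ℕ) (x y : V d) :
    step d (n + 1) x y = ∑ z ∈ nbrs y, (1 / (2 * (d : ℝ))) * step d n x z := by
  induction n generalizing x with
  | zero =>
    simp only [step, mul_ite, mul_one, mul_zero, Finset.sum_ite_eq, Finset.sum_ite_eq']
    exact if_congr ⟨mem_nbrs_symm, mem_nbrs_symm⟩ rfl rfl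
  | succ n ih =>
    rw [step]
    simp_rw [ih, Finset.mul_sum]
    rw [Finset.sum_comm]
    refine Finset.sum_congr rfl fun w _ => ?_
    rw [step, Finset.mul_sum]

lemma step_comm (n : ℕ) (x y : V d) : step d n x y = step d n y x := by
  induction n generalizing x with
  | zero => simp only [step, eq_comm]
  | succ n ih =>
    rw [step, step_succ_right]
    exact Finset.sum_congr rfl fun z _ => by rw [ih]

lemma green_comm (x y : V d) : green x y = green y x := by
  simp only [green, step_comm _ x y]

lemma green_nonneg (x y : V d) : 0 ≤ green x y := tsum_nonneg fun n => step_nonneg n x y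

lemma summable_step_left (hd : 0 < d) {x y : V d} (h : Summable fun n => step d n x y)
    (x' : V d) : Summable fun n => step d n x' y := by
  refine forall_of_nbrs (Q := fun x => Summable fun n => step d n x y) x h ?_ x'
  intro u hu z hz
  have h1 := (((summable_nat_add_iff 1).2 hu).mul_left (2 * (d : ℝ)))
  refine Summable.of_nonneg_of_le (fun n => step_nonneg n z y) (fun n => ?_) h1
  have h2 : (1 / (2 * (d : ℝ))) * step d n z y ≤ step d (n + 1) u y :=
    Finset.single_le_sum (f := fun z => (1 / (2 * (d : ℝ))) * step d n z y)
      (fun z _ => mul_nonneg (by positivity) (step_nonneg n z y)) hz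
  have hd' : (0 : ℝ) < d := by positivity
  calc step d n z y = 2 * (d : ℝ) * ((1 / (2 * (d : ℝ))) * step d n z y) := by field_simp
    _ ≤ _ := mul_le_mul_of_nonneg_left h2 (by positivity)

lemma summable_step (hd : 0 < d) (h : Summable fun n => step d n (0 : V d) 0) (x y : V d) :
    Summable fun n => step d n x y := by
  refine summable_step_left hd (x := 0) ?_ x
  simp_rw [step_comm _ 0 y]
  exact summable_step_left hd h y

lemma avg_pow_eq_sum (A : Finset (V d)) (f : V d → ℝ) (hf : ∀ x ∉ A, f x = 0) (n : ℕ) (x : V d) :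
    (avg d ^ n) f x = ∑ y ∈ A, step d n x y * f y := by
  induction n generalizing x with
  | zero =>
    simp only [pow_zero, Module.End.one_apply, step, ite_mul, one_mul, zero_mul,
      Finset.sum_ite_eq]
    split_ifs with h
    · rfl
    · exact hf x h
  | succ n ih =>
    rw [avg_pow_succ, avg_apply]
    simp_rw [ih, Finset.mul_sum, step, Finset.sum_mul]
    rw [Finset.sum_comm]
    exact Finset.sum_congr rfl fun y _ => Finset.sum_congr rfl fun z _ => by ring

lemma hasSum_green (ht : ∀ x y : V d, Summable fun n => step d n x y) (A : Finset (V d))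
    (f : V d → ℝ) (hf : ∀ x ∉ A, f x = 0) (x : V d) :
    HasSum (fun n => (avg d ^ n) f x) (∑ y ∈ A, green x y * f y) := by
  simp_rw [avg_pow_eq_sum A f hf]
  exact hasSum_sum fun y _ => (ht x y).hasSum.mul_right (f y)

lemma hitBE_succ (A : Finset (V d)) (n : ℕ) (x : V d) :
    hitBE A Set.univ (n + 1) x = if x ∈ A then 1 else avg d (hitBE A Set.univ n) x := by
  simp [hitBE, avg_apply]

lemma hitBE_nonneg (A : Finset (V d)) (n : ℕ) : 0 ≤ hitBE A Set.univ n := by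
  induction n with
  | zero => intro x; simp only [hitBE]; split_ifs <;> simp
  | succ n ih =>
    intro x
    rw [hitBE_succ]
    split_ifs
    · simp
    · simpa using avg_mono ih x

lemma hitBE_le_one (hd : 0 < d) (A : Finset (V d)) (n : ℕ) : hitBE A Set.univ n ≤ 1 := by
  induction n with
  | zero => intro x; simp only [hitBE]; split_ifs <;> simp
  | succ n ih =>
    intro x
    rw [hitBE_succ]
    split_ifs
    · simp
    · exact (avg_mono ih x).trans (avg_one hd x).le

lemma hitBE_mono (A : Finset (V d)) : Monotone (hitBE A Set.univ) := by
  refine monotone_nat_of_le_succ fun n => ?_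
  induction n with
  | zero =>
    intro x
    rw [hitBE_succ]
    split_ifs with hx
    · simp [hitBE, hx]
    · simpa [hitBE, hx] using avg_mono (hitBE_nonneg A 0) x
  | succ n ih =>
    intro x
    rw [hitBE_succ, hitBE_succ]
    split_ifs
    · rfl
    · exact avg_mono ih x

lemma tendsto_hitBE (hd : 0 < d) (A : Finset (V d)) (x : V d) :
    Tendsto (fun n => hitBE A Set.univ n x) atTop (nhds (hitProb A x)) :=
  tendsto_atTop_ciSup (fun _ _ h => hitBE_mono A h x)
    ⟨1, by rintro _ ⟨n, rfl⟩; exact hitBE_le_one hd A n x⟩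

lemma tendsto_avg {f : ℕ → V d → ℝ} {g : V d → ℝ}
    (h : ∀ x, Tendsto (fun n => f n x) atTop (nhds (g x))) (x : V d) :
    Tendsto (fun n => avg d (f n) x) atTop (nhds (avg d g x)) :=
  tendsto_finsetSum _ fun z _ => (h z).const_mul _

lemma tendsto_avg_pow {f : ℕ → V d → ℝ} {g : V d → ℝ}
    (h : ∀ x, Tendsto (fun n => f n x) atTop (nhds (g x))) (N : ℕ) (x : V d) :
    Tendsto (fun n => (avg d ^ N) (f n) x) atTop (nhds ((avg d ^ N) g x)) := by
  induction N generalizing x with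
  | zero => simpa using h x
  | succ N ih =>
    simp_rw [avg_pow_succ]
    exact tendsto_avg ih x

lemma hitProb_eq (hd : 0 < d) (A : Finset (V d)) (x : V d) :
    hitProb A x = if x ∈ A then 1 else avg d (hitProb A) x := by
  refine tendsto_nhds_unique ((tendsto_add_atTop_iff_nat 1).2 (tendsto_hitBE hd A x)) ?_
  simp_rw [hitBE_succ]
  split_ifs
  · exact tendsto_const_nhds
  · exact tendsto_avg (tendsto_hitBE hd A) x

lemma hitProb_nonneg (hd : 0 < d) (A : Finset (V d)) : 0 ≤ hitProb A := fun x =>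
  ge_of_tendsto' (tendsto_hitBE hd A x) fun n => hitBE_nonneg A n x

lemma hitProb_le_one (hd : 0 < d) (A : Finset (V d)) : hitProb A ≤ 1 := fun x =>
  le_of_tendsto' (tendsto_hitBE hd A x) fun n => hitBE_le_one hd A n x

lemma eqm_of_notMem (A : Finset (V d)) (x : V d) (hx : x ∉ A) : eqm A x = 0 := by
  simp [eqm, hx]

lemma eqm_nonneg (hd : 0 < d) (A : Finset (V d)) (x : V d) : 0 ≤ eqm A x := by
  unfold eqm
  split_ifs
  · exact Finset.sum_nonneg fun z _ =>
      mul_nonneg (by positivity) (sub_nonneg.2 (hitProb_le_one hd A z))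
  · rfl

lemma eqm_eq (hd : 0 < d) (A : Finset (V d)) : eqm A = hitProb A - avg d (hitProb A) := by
  ext x
  rw [Pi.sub_apply, hitProb_eq hd A x]
  split_ifs with hx
  · have : eqm A x = avg d (1 - hitProb A) x := by
      simp only [eqm, hx, if_true, avg_apply, Pi.sub_apply, Pi.one_apply]
    rw [this, map_sub, Pi.sub_apply, avg_one hd]
  · simp [eqm_of_notMem A x hx]

lemma sum_avg_pow_eqm (hd : 0 < d) (A : Finset (V d)) (N : ℕ) (x : V d) :
    ∑ n ∈ Finset.range N, (avg d ^ n) (eqm A) x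
      = hitProb A x - (avg d ^ N) (hitProb A) x := by
  induction N with
  | zero => simp
  | succ N ih =>
    rw [Finset.sum_range_succ, ih, eqm_eq hd, map_sub, Pi.sub_apply, ← Module.End.mul_apply,
      ← pow_succ]
    ring

lemma hitBE_le_sum (A : Finset (V d)) (n : ℕ) :
    hitBE A Set.univ n ≤
      ∑ k ∈ Finset.range (n + 1), (avg d ^ k) (fun x => if x ∈ A then 1 else 0) := by
  have h0 : ∀ k, 0 ≤ (avg d ^ k) (fun x => if x ∈ A then (1 : ℝ) else 0) := fun k => by
    simpa using avg_pow_mono k (show (0 : V d → ℝ) ≤ fun x => if x ∈ A then (1 : ℝ) else 0 from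
      fun x => by dsimp only; split_ifs <;> simp)
  induction n with
  | zero => intro x; simp [hitBE]
  | succ n ih =>
    intro x
    rw [hitBE_succ, Finset.sum_range_succ', Pi.add_apply]
    split_ifs with hx
    · have := Finset.sum_nonneg (s := Finset.range (n + 1)) (fun k _ => h0 (k + 1)) x
      simpa [hx] using this
    · refine (avg_mono ih x).trans ?_
      simp [map_sum, avg_pow_succ, hx]

/-- Transience: a finite set is eventually not visited any more. -/
lemma tendsto_avg_pow_hitProb (hd : 0 < d) (ht : ∀ x y : V d, Summable fun n => step d n x y)
    (A : Finset (V d)) (x : V d) :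
    Tendsto (fun N => (avg d ^ N) (hitProb A) x) atTop (nhds 0) := by
  set f : V d → ℝ := fun x => if x ∈ A then (1 : ℝ) else 0 with hf
  have hs : Summable fun n => (avg d ^ n) f x :=
    (hasSum_green ht A f (fun x hx => by simp [hf, hx]) x).summable
  have hf0 : ∀ k, 0 ≤ (avg d ^ k) f := fun k => by
    simpa using avg_pow_mono k (show (0 : V d → ℝ) ≤ f from
      fun x => by simp only [hf]; split_ifs <;> simp)
  refine tendsto_of_tendsto_of_tendsto_of_le_of_le tendsto_const_nhds
    (tendsto_sum_nat_add fun n => (avg d ^ n) f x) (fun N => ?_) (fun N => ?_)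
  · simpa using avg_pow_mono N (hitProb_nonneg hd A) x
  · refine le_of_tendsto' (tendsto_avg_pow (tendsto_hitBE hd A) N x) fun n => ?_
    refine (avg_pow_mono N (hitBE_le_sum A n) x).trans ?_
    rw [map_sum, Finset.sum_apply]
    simp_rw [← Module.End.mul_apply, ← pow_add, add_comm N]
    exact ((summable_nat_add_iff N).2 hs).sum_le_tsum _ fun k _ => hf0 _ x

/-- The equilibrium measure has potential `G e_A = P_x[H_A < ∞]`. -/
lemma sum_green_eqm (hd : 0 < d) (ht : ∀ x y : V d, Summable fun n => step d n x y)
    (A : Finset (V d)) (x : V d) : ∑ y ∈ A, green x y * eqm A y = hitProb A x := by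
  refine tendsto_nhds_unique
    (hasSum_green ht A (eqm A) (eqm_of_notMem A) x).tendsto_sum_nat ?_
  simp_rw [sum_avg_pow_eqm hd]
  simpa using (tendsto_avg_pow_hitProb hd ht A x).const_sub (hitProb A x)

lemma capa_nonneg (hd : 0 < d) (A : Finset (V d)) : 0 ≤ capa A :=
  Finset.sum_nonneg fun x _ => eqm_nonneg hd A x

/-- A superposition of scaled equilibrium measures of subsets of `A` whose potential is at most
`C` on `A` has mass at most `C * cap A`. -/
lemma sum_mul_capa_le {ι : Type*} (hd : 0 < d)
    (ht : ∀ x y : V d, Summable fun n => step d n x y) (A : Finset (V d)) (W : Finset ι)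
    (B : ι → Finset (V d)) (hB : ∀ w ∈ W, B w ⊆ A) (t : ι → ℝ) (C : ℝ)
    (hC : ∀ x ∈ A, ∑ w ∈ W, t w * ∑ y ∈ B w, green x y * eqm (B w) y ≤ C) :
    ∑ w ∈ W, t w * capa (B w) ≤ C * capa A := by
  have h1 : ∀ w ∈ W, t w * capa (B w)
      = ∑ x ∈ A, eqm A x * (t w * ∑ y ∈ B w, green x y * eqm (B w) y) := by
    intro w hw
    have : ∀ y ∈ B w, eqm (B w) y = ∑ x ∈ A, green y x * eqm A x * eqm (B w) y := by
      intro y hy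
      rw [← Finset.sum_mul, sum_green_eqm hd ht, hitProb_eq hd, if_pos (hB w hw hy), one_mul]
    rw [capa, Finset.sum_congr rfl this, Finset.sum_comm, Finset.mul_sum]
    refine Finset.sum_congr rfl fun x _ => ?_
    simp only [Finset.mul_sum]
    exact Finset.sum_congr rfl fun y _ => by rw [green_comm]; ring
  rw [Finset.sum_congr rfl h1, Finset.sum_comm, capa, Finset.mul_sum]
  refine Finset.sum_le_sum fun x hx => ?_
  rw [← Finset.mul_sum, mul_comm]
  exact mul_le_mul_of_nonneg_right (hC x hx) (eqm_nonneg hd A x)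

lemma card_box (x : V d) {L : ℤ} (hL : 0 ≤ L) : ((box x L).card : ℝ) = (L : ℝ) ^ d := by
  lift L to ℕ using hL
  simp [box, Fintype.card_piFinset]

lemma card_box_rpow (hd : 3 ≤ d) (x : V d) {L : ℤ} (hL : 0 ≤ L) :
    ((box x L).card : ℝ) ^ ((d - 2 : ℝ) / d) = (L : ℝ) ^ (d - 2) := by
  have h0 : (0 : ℝ) ≤ L := by exact_mod_cast hL
  have hd' : (d : ℝ) ≠ 0 := by positivity
  rw [card_box x hL, ← Real.rpow_natCast, ← Real.rpow_mul h0, mul_div_cancel₀ _ hd',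
    ← Real.rpow_natCast]
  congr 1
  rw [Nat.cast_sub (by omega), Nat.cast_ofNat]

lemma abs_le_eNorm (x : V d) (i : Fin d) : |(x i : ℝ)| ≤ eNorm x := by
  rw [← Real.sqrt_sq_eq_abs]
  exact Real.sqrt_le_sqrt
    (Finset.single_le_sum (f := fun i => (x i : ℝ) ^ 2) (fun i _ => sq_nonneg _)
      (Finset.mem_univ i))

lemma green_le {cstar : ℝ}
    (hc : ∀ x y : V d, green x y * eNorm (y - x) ^ (d - 2) ≤ cstar) {L : ℤ} (hL : 0 < L)
    (x y : V d) (i : Fin d) (h : L ≤ |y i - x i|) : green x y ≤ cstar / (L : ℝ) ^ (d - 2) := by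
  have hL' : (0 : ℝ) < L := by exact_mod_cast hL
  rw [le_div_iff₀ (by positivity)]
  refine le_trans ?_ (hc x y)
  refine mul_le_mul_of_nonneg_left (pow_le_pow_left₀ hL'.le ?_ _) (green_nonneg x y)
  refine le_trans ?_ (abs_le_eNorm (y - x) i)
  rw [Pi.sub_apply]
  exact_mod_cast h

/-- The potential at `x` of scaled equilibrium measures of sets in the subboxes of side `L`: the
boxes near `x` contribute at most `3 ^ d` and the others at most `1`. -/
lemma sum_potential_le (hd : 0 < d) (ht : ∀ x y : V d, Summable fun n => step d n x y) {cstar : ℝ}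
    (hc : ∀ x y : V d, green x y * eNorm (y - x) ^ (d - 2) ≤ cstar) (hc0 : 0 ≤ cstar)
    {L : ℤ} (hL : 0 < L) (x₀ : V d) (W : Finset (V d)) (B : V d → Finset (V d))
    (hB : ∀ w ∈ W, B w ⊆ box (fun i => x₀ i + L * w i) L) (t : V d → ℝ) (ht0 : ∀ w, 0 ≤ t w)
    (ht1 : ∀ w, t w ≤ 1) {s : ℝ} (hs : ∀ w, t w * capa (B w) ≤ s) (hs0 : 0 ≤ s)
    (hsW : W.card * (cstar / (L : ℝ) ^ (d - 2) * s) ≤ 1) (x : V d) :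
    ∑ w ∈ W, t w * ∑ y ∈ B w, green x y * eqm (B w) y ≤ 3 ^ d + 1 := by
  have hL' : (0 : ℝ) < L := by exact_mod_cast hL
  set w₀ : V d := fun i => (x i - x₀ i) / L with hw₀
  rw [← Finset.sum_filter_add_sum_filter_not W (fun w => w ∈ ball w₀ 1)]
  refine add_le_add ?_ ?_
  · have h1 : ∀ w ∈ W.filter (fun w => w ∈ ball w₀ 1),
        t w * ∑ y ∈ B w, green x y * eqm (B w) y ≤ 1 := fun w _ => by
      rw [sum_green_eqm hd ht]
      exact mul_le_one₀ (ht1 w) (hitProb_nonneg hd _ x) (hitProb_le_one hd _ x)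
    refine (Finset.sum_le_card_nsmul _ _ _ h1).trans ?_
    have h2 : (W.filter (fun w => w ∈ ball w₀ 1)).card ≤ 3 ^ d := by
      refine (Finset.card_le_card (t := ball w₀ 1) fun w hw => (Finset.mem_filter.1 hw).2).trans ?_
      have : ∀ a : ℤ, (a + 1 + 1 - (a - 1)).toNat = 3 := fun a => by
        rw [show a + 1 + 1 - (a - 1) = 3 by ring]; rfl
      simp [ball, Fintype.card_piFinset, this]
    rw [nsmul_eq_mul, mul_one]
    exact_mod_cast h2
  · have h1 : ∀ w ∈ W.filter (fun w => w ∉ ball w₀ 1),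
        t w * ∑ y ∈ B w, green x y * eqm (B w) y ≤ cstar / (L : ℝ) ^ (d - 2) * s := by
      intro w hw
      obtain ⟨hwW, hwb⟩ := Finset.mem_filter.1 hw
      simp only [ball, Fintype.mem_piFinset, Finset.mem_Icc, not_forall] at hwb
      obtain ⟨i, hi⟩ := hwb
      have h2 : ∑ y ∈ B w, green x y * eqm (B w) y
          ≤ cstar / (L : ℝ) ^ (d - 2) * capa (B w) := by
        rw [capa, Finset.mul_sum]
        refine Finset.sum_le_sum fun y hy => mul_le_mul_of_nonneg_right ?_ (eqm_nonneg hd _ y)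
        refine green_le hc hL x y i ?_
        have hy' := hB w hwW hy
        simp only [box, Fintype.mem_piFinset, Finset.mem_Ico] at hy'
        have h3 := hy' i
        have h4 := Int.mul_ediv_add_emod (x i - x₀ i) L
        have h5 := Int.emod_nonneg (x i - x₀ i) hL.ne'
        have h6 := Int.emod_lt_of_pos (x i - x₀ i) hL
        change L * w₀ i + _ = _ at h4
        rw [le_abs]
        by_cases h7 : w₀ i - 1 ≤ w i
        · left
          have : w₀ i + 2 ≤ w i := by omega
          nlinarith
        · right
          have : w i + 2 ≤ w₀ i := by omega
          nlinarith
      calc t w * ∑ y ∈ B w, green x y * eqm (B w) y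
          ≤ t w * (cstar / (L : ℝ) ^ (d - 2) * capa (B w)) :=
            mul_le_mul_of_nonneg_left h2 (ht0 w)
        _ = cstar / (L : ℝ) ^ (d - 2) * (t w * capa (B w)) := by ring
        _ ≤ _ := mul_le_mul_of_nonneg_left (hs w) (by positivity)
    refine (Finset.sum_le_card_nsmul _ _ _ h1).trans (le_trans ?_ hsW)
    rw [nsmul_eq_mul]
    refine mul_le_mul_of_nonneg_right ?_ (by positivity)
    exact_mod_cast Finset.card_filter_le _ _

/-- A subbox of the `M`-adic partition is contained in the large box. -/
lemma subbox_subset (x₀ : V d) {M : ℕ} {L : ℤ} (hL : 0 ≤ L) {w : V d}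
    (hw : w ∈ Fintype.piFinset (fun _ : Fin d => Finset.Icc (0 : ℤ) ((M : ℤ) - 1))) :
    box (fun i => x₀ i + L * w i) L ⊆ box x₀ ((M : ℤ) * L) := by
  intro x hx
  simp only [box, Fintype.mem_piFinset, Finset.mem_Ico, Finset.mem_Icc] at hx hw ⊢
  intro i
  have h1 := hx i
  have h2 := hw i
  constructor <;> nlinarith

/-- Scaling a nonnegative mass down to level `s`. -/
lemma exists_scaling {c s : ℝ} (hc : 0 ≤ c) (hs : 0 ≤ s) :
    ∃ t : ℝ, 0 ≤ t ∧ t ≤ 1 ∧ t * c = min c s := by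
  rcases le_total c s with h | h
  · exact ⟨1, zero_le_one, le_rfl, by rw [min_eq_left h, one_mul]⟩
  · refine ⟨s / c, by positivity, div_le_one_of_le₀ h hc, ?_⟩
    rw [min_eq_right h]
    exact div_mul_cancel_of_imp fun hc' => by linarith

/-- Lemma 2.2, capacity growth-saturation across scales: with
`c_* = sup { g(x,y)·|y-x|^{d-2} }`, `η₀ = (c_* M^d)⁻¹`, `η̃₀ = η₀/2`, and
`L₁^{d-2} g(0,0) > 2 c_* M^d`, for a box `B̄` of side `M·L` (`L ≥ L₁`) partitioned
into its `M^d` subboxes `B̂` of side `L`: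
`cap(B̄∩F)/|B̄|^{(d-2)/d} ≥ (M²/(3^d+1)) · M^{-d} · Σ_{B̂} min(cap(B̂∩F)/|B̂|^{(d-2)/d}, η̃₀)`. -/
theorem cost_bubble_stmt6 (d : ℕ) (hd : 3 ≤ d) (M : ℕ) (hM4 : 4 < M)
    (hM : (3 : ℝ) ^ d + 1 < (M : ℝ) ^ 2)
    (cstar : ℝ)
    (hcstar : IsLUB {r : ℝ | ∃ x y : V d, r = green x y * eNorm (y - x) ^ (d - 2)} cstar)
    (η₀ ηt₀ : ℝ) (hη₀ : η₀ = (cstar * (M : ℝ) ^ d)⁻¹) (hηt₀ : ηt₀ = η₀ / 2)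
    (L L₁ : ℤ) (hL₁ : 1 ≤ L₁) (hL : L₁ ≤ L)
    (hscale : 2 * cstar * (M : ℝ) ^ d < (L₁ : ℝ) ^ (d - 2) * green (0 : V d) 0)
    (F : Set (V d)) (x₀ : V d) :
    ((M : ℝ) ^ 2 / ((3 : ℝ) ^ d + 1)) * (1 / (M : ℝ) ^ d) *
        ∑ w ∈ Fintype.piFinset (fun _ : Fin d => Finset.Icc (0 : ℤ) ((M : ℤ) - 1)),
          min (capa (((box (fun i => x₀ i + L * w i) L)).filter (· ∈ F)) /
              (((box (fun i => x₀ i + L * w i) L).card : ℝ)) ^ ((d - 2 : ℝ) / d)) ηt₀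
      ≤ capa ((box x₀ ((M : ℤ) * L)).filter (· ∈ F)) /
          (((box x₀ ((M : ℤ) * L)).card : ℝ)) ^ ((d - 2 : ℝ) / d) := by
  have hd0 : 0 < d := by omega
  have hc : ∀ x y : V d, green x y * eNorm (y - x) ^ (d - 2) ≤ cstar := fun x y =>
    hcstar.1 ⟨x, y, rfl⟩
  have hc0 : 0 ≤ cstar := (mul_nonneg (green_nonneg (0 : V d) 0)
    (pow_nonneg (Real.sqrt_nonneg _) _)).trans (hc 0 0)
  have hsum : Summable fun n => step d n (0 : V d) 0 := by
    by_contra h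
    rw [green, tsum_eq_zero_of_not_summable h, mul_zero] at hscale
    exact hscale.not_ge (by positivity)
  have ht := summable_step hd0 hsum
  have hLpos : 0 < L := by omega
  have hL' : (0 : ℝ) < L := by exact_mod_cast hLpos
  have hM0 : (0 : ℝ) < M := by exact_mod_cast (by omega : 0 < M)
  have hη0 : 0 ≤ ηt₀ := by rw [hηt₀, hη₀]; positivity
  have hη1 : (M : ℝ) ^ d * (cstar * ηt₀) ≤ 1 := by
    rcases hc0.eq_or_lt with h | h
    · rw [← h]; simp
    · rw [hηt₀, hη₀]
      have : (M : ℝ) ^ d * (cstar * ((cstar * (M : ℝ) ^ d)⁻¹ / 2)) = 1 / 2 := by field_simp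
      rw [this]; norm_num
  set W := Fintype.piFinset (fun _ : Fin d => Finset.Icc (0 : ℤ) ((M : ℤ) - 1)) with hW
  have hWcard : (W.card : ℝ) = (M : ℝ) ^ d := by simp [hW, Fintype.card_piFinset]
  rw [card_box_rpow hd x₀ (by positivity)]
  simp_rw [card_box_rpow hd _ hLpos.le]
  set A := (box x₀ ((M : ℤ) * L)).filter (· ∈ F)
  set B : V d → Finset (V d) := fun w => (box (fun i => x₀ i + L * w i) L).filter (· ∈ F) with hB
  have hs0 : 0 ≤ ηt₀ * (L : ℝ) ^ (d - 2) := by positivity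
  choose t t0 t1 tmin using fun w => exists_scaling (capa_nonneg hd0 (B w)) hs0
  have key : ∑ w ∈ W, t w * capa (B w) ≤ (3 ^ d + 1) * capa A := by
    refine sum_mul_capa_le hd0 ht A W B
      (fun w hw => Finset.filter_subset_filter _ (subbox_subset x₀ hLpos.le hw)) t _ fun x _ => ?_
    refine sum_potential_le hd0 ht hc hc0 hLpos x₀ W B (fun w _ => Finset.filter_subset _ _) t t0 t1
      (fun w => (tmin w).trans_le (min_le_right _ _)) hs0 ?_ x
    rw [hWcard]
    refine le_trans (le_of_eq ?_) hη1
    field_simp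
  have hmin : ∀ w, min (capa (B w) / (L : ℝ) ^ (d - 2)) ηt₀
      = t w * capa (B w) / (L : ℝ) ^ (d - 2) := fun w => by
    rw [tmin, ← min_div_div_right (by positivity), mul_div_cancel_right₀ _ (by positivity)]
  change _ * ∑ w ∈ W, min (capa (B w) / (L : ℝ) ^ (d - 2)) ηt₀ ≤ _
  simp_rw [hmin]
  rw [← Finset.sum_div]
  push_cast
  have hMd : (M : ℝ) ^ d = (M : ℝ) ^ 2 * (M : ℝ) ^ (d - 2) := by
    rw [← pow_add]; congr 1; omega
  calc (M : ℝ) ^ 2 / (3 ^ d + 1) * (1 / (M : ℝ) ^ d)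
        * ((∑ w ∈ W, t w * capa (B w)) / (L : ℝ) ^ (d - 2))
      ≤ (M : ℝ) ^ 2 / (3 ^ d + 1) * (1 / (M : ℝ) ^ d)
        * (((3 ^ d + 1) * capa A) / (L : ℝ) ^ (d - 2)) := by gcongr
    _ = capa A / ((M : ℝ) * L) ^ (d - 2) := by
      rw [hMd, mul_pow]
      field_simp

end
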